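/- Let t be an integer with t ≡ 1 (mod 3) or t ≡ 2 (mod 3). Then for all n ≥ 1, P_n^σ(i·t) ≠ 0, where i is the imaginary unit in ℂ and P_n^σ are the D'Arcais polynomials. -/

import Mathlib

open Polynomial

/-- The polynomials `P_n^g ∈ ℚ[X]` defined by `P_0^g = 1` and
`P_n^g = (x/n) ∑_{k=1}^n g(k) P_{n-k}^g` for `n ≥ 1`. -/
noncomputable def darcais (g : ℕ → ℤ) : ℕ → ℚ[X]
  | 0 => 1
  | n + 1 =>
      C (((n : ℚ) + 1)⁻¹) * X *
        ∑ k ∈ Finset.range (n + 1), C ((g (k + 1) : ℚ)) * darcais g (n - k)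
  decreasing_by exact Nat.sub_lt_succ n k

/-- `A_n^g := n! ⬝ P_n^g`. -/
noncomputable def darcaisA (g : ℕ → ℤ) (n : ℕ) : ℚ[X] :=
  (n.factorial : ℚ[X]) * darcais g n

/-- Sum-of-divisors function `σ` as a `ℤ`-valued arithmetic function. -/
def sigma' (n : ℕ) : ℤ := ∑ d ∈ n.divisors, (d : ℤ)

/-- The values at `x` of the integral polynomials `n! ⬝ P_n^g`, in an arbitrary commutative ring. -/
def darcaisInt {R : Type*} [CommRing R] (g : ℕ → ℤ) (x : R) : ℕ → R
  | 0 => 1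
  | n + 1 => x * ∑ k ∈ Finset.range (n + 1),
      (g (k + 1) : R) * (n.descFactorial k : R) * darcaisInt g x (n - k)
  decreasing_by exact Nat.sub_lt_succ n k

theorem map_darcaisInt {R S : Type*} [CommRing R] [CommRing S] (f : R →+* S) (g : ℕ → ℤ) (x : R)
    (n : ℕ) : f (darcaisInt g x n) = darcaisInt g (f x) n := by
  induction n using Nat.strong_induction_on with
  | _ n ih =>
    cases n with
    | zero => simp [darcaisInt]
    | succ n =>
      rw [darcaisInt, darcaisInt, map_mul, map_sum]
      congr 1
      refine Finset.sum_congr rfl fun k _ => ?_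
      rw [map_mul, map_mul, map_intCast, map_natCast, ih _ (Nat.sub_lt_succ n k)]

theorem darcaisInt_eq_factorial_mul_aeval {K : Type*} [Field K] [CharZero K] (g : ℕ → ℤ) (x : K)
    (n : ℕ) : darcaisInt g x n = n.factorial * aeval x (darcais g n) := by
  induction n using Nat.strong_induction_on with
  | _ n ih =>
    cases n with
    | zero => simp [darcaisInt, darcais]
    | succ n =>
      have hn : (n : K) + 1 ≠ 0 := by exact_mod_cast n.succ_ne_zero
      rw [darcaisInt, darcais, map_mul, map_mul, map_sum, aeval_C, aeval_X, Nat.factorial_succ]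
      have hc : algebraMap ℚ K ((n : ℚ) + 1)⁻¹ = ((n : K) + 1)⁻¹ := by simp
      rw [hc]
      push_cast
      have hr : ((n : K) + 1) * n.factorial * (((n : K) + 1)⁻¹ * x *
          ∑ k ∈ Finset.range (n + 1), aeval x (C (g (k + 1) : ℚ) * darcais g (n - k))) =
          x * (n.factorial *
            ∑ k ∈ Finset.range (n + 1), aeval x (C (g (k + 1) : ℚ) * darcais g (n - k))) := by
        field_simp
      rw [hr]
      congr 1
      rw [Finset.mul_sum]
      refine Finset.sum_congr rfl fun k hk => ?_
      have hkn : k ≤ n := Nat.lt_succ_iff.mp (Finset.mem_range.mp hk)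
      rw [ih _ (Nat.sub_lt_succ n k), map_mul, aeval_C, map_intCast,
        ← Nat.factorial_mul_descFactorial hkn]
      push_cast
      ring

theorem three_dvd_descFactorial (n k : ℕ) (hk : 3 ≤ k) : 3 ∣ n.descFactorial k :=
  (Nat.dvd_factorial (by norm_num) hk).trans (Nat.factorial_dvd_descFactorial n k)

/-- Modulo `3` only the first three terms of the recursion survive. -/
theorem darcaisInt_sigma_add_three {R : Type*} [CommRing R] [CharP R 3] (x : R) (n : ℕ) :
    darcaisInt sigma' x (n + 3) =
      x * (darcaisInt sigma' x (n + 2) + (n + 2) * (n + 1) * darcaisInt sigma' x n) := by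
  have h3 : (3 : R) = 0 := by exact_mod_cast CharP.cast_eq_zero R 3
  have s1 : sigma' 1 = 1 := by decide
  have s2 : sigma' 2 = 3 := by decide
  have s3 : sigma' 3 = 4 := by decide
  rw [darcaisInt, Finset.sum_range_succ', Finset.sum_range_succ', Finset.sum_range_succ',
    Finset.sum_eq_zero]
  · simp only [Nat.descFactorial_succ, Nat.descFactorial_zero, zero_add, Nat.reduceAdd, s1, s2, s3,
      Nat.add_sub_cancel, Nat.sub_zero]
    have e1 : n + 2 - 1 = n + 1 := rfl
    rw [e1]
    push_cast
    linear_combination x * ((n + 2) * darcaisInt sigma' x (n + 1) +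
      (n + 2) * (n + 1) * darcaisInt sigma' x n) * h3
  · intro k _
    rw [(CharP.cast_eq_zero_iff R 3 _).mpr (three_dvd_descFactorial _ _ (by omega))]
    ring

theorem darcaisInt_sigma_one {R : Type*} [CommRing R] (x : R) : darcaisInt sigma' x 1 = x := by
  have s1 : sigma' 1 = 1 := by decide
  simp [darcaisInt, s1]

theorem darcaisInt_sigma_two {R : Type*} [CommRing R] [CharP R 3] (x : R) :
    darcaisInt sigma' x 2 = x ^ 2 := by
  have h3 : (3 : R) = 0 := by exact_mod_cast CharP.cast_eq_zero R 3
  have s1 : sigma' 1 = 1 := by decide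
  have s2 : sigma' 2 = 3 := by decide
  rw [darcaisInt]
  simp [Finset.sum_range_succ, darcaisInt_sigma_one, s1, s2, h3, sq]

theorem darcaisInt_sigma_residues {R : Type*} [CommRing R] [CharP R 3] (x : R) (j : ℕ) :
    darcaisInt sigma' x (3 * j) = (x ^ 3 - x) ^ j ∧
      darcaisInt sigma' x (3 * j + 1) = x * (x ^ 3 - x) ^ j ∧
      darcaisInt sigma' x (3 * j + 2) = x ^ 2 * (x ^ 3 - x) ^ j := by
  have h3 : (3 : R) = 0 := by exact_mod_cast CharP.cast_eq_zero R 3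
  induction j with
  | zero => simp [darcaisInt_sigma_one, darcaisInt_sigma_two, darcaisInt]
  | succ j ih =>
    obtain ⟨h0, h1, h2⟩ := ih
    have e0 := darcaisInt_sigma_add_three x (3 * j)
    have e1 := darcaisInt_sigma_add_three x (3 * j + 1)
    have e2 := darcaisInt_sigma_add_three x (3 * j + 2)
    push_cast [h0, h1, h2, h3, add_assoc] at e0 e1 e2
    norm_num at e0 e1 e2
    have k0 : darcaisInt sigma' x (3 * j + 3) = (x ^ 3 - x) ^ (j + 1) := by
      rw [e0]
      linear_combination x * (x ^ 3 - x) ^ j * h3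
    have k1 : darcaisInt sigma' x (3 * j + 4) = x * (x ^ 3 - x) ^ (j + 1) := by
      rw [e1, k0]
      linear_combination 2 * x ^ 2 * (x ^ 3 - x) ^ j * h3
    refine ⟨k0, k1, ?_⟩
    rw [show 3 * (j + 1) + 2 = 3 * j + 5 by ring, e2, k1]
    linear_combination 4 * x ^ 3 * (x ^ 3 - x) ^ j * h3

theorem darcaisInt_sigma_ne_zero {K : Type*} [Field K] [CharP K 3] {x : K} (hx : x ^ 2 = -1)
    (n : ℕ) : darcaisInt sigma' x n ≠ 0 := by
  have h3 : (3 : K) = 0 := by exact_mod_cast CharP.cast_eq_zero K 3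
  have hx0 : x ≠ 0 := by
    rintro rfl
    simp at hx
  have hu : x ^ 3 - x = x := by linear_combination x * hx - x * h3
  obtain ⟨h0, h1, h2⟩ := darcaisInt_sigma_residues x (n / 3)
  rw [hu] at h0 h1 h2
  have hn : n = 3 * (n / 3) ∨ n = 3 * (n / 3) + 1 ∨ n = 3 * (n / 3) + 2 := by omega
  rcases hn with h | h | h <;> rw [h]
  · rw [h0]
    positivity
  · rw [h1]
    positivity
  · rw [h2]
    positivity

/-- For every integer `t` with `t ≡ 1 (mod 3)` or `t ≡ 2 (mod 3)` and all `n ≥ 1`,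
`P_n^σ(i⬝t) ≠ 0`. -/
theorem darcaisSigma_ne_zero_at_It (t : ℤ) (ht : t % 3 = 1 ∨ t % 3 = 2)
    (n : ℕ) (hn : 1 ≤ n) :
    aeval (Complex.I * (t : ℂ)) (darcais sigma' n) ≠ 0 := by
  intro h
  let x : GaussianInt := ⟨0, t⟩
  have hxC : GaussianInt.toComplex x = Complex.I * t := by
    simp [x, GaussianInt.toComplex_def, mul_comm]
  have hb : darcaisInt sigma' x n = 0 := by
    rw [← GaussianInt.toComplex_eq_zero, map_darcaisInt, hxC,
      darcaisInt_eq_factorial_mul_aeval, h, mul_zero]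
  let K := AlgebraicClosure (ZMod 3)
  obtain ⟨r, hr⟩ := IsAlgClosed.exists_pow_nat_eq (-1 : K) (n := 2) (by norm_num)
  let f : GaussianInt →+* K := Zsqrtd.lift ⟨r, by push_cast; rw [← sq, hr]⟩
  have : CharP K 3 := inferInstance
  have ht2 : (t : K) ^ 2 = 1 := by
    have hd : (3 : ℤ) ∣ t ^ 2 - 1 := by
      apply Int.dvd_of_emod_eq_zero
      rcases ht with h | h <;> simp [Int.sub_emod, pow_two, Int.mul_emod, h]
    have := (CharP.intCast_eq_zero_iff K 3 (t ^ 2 - 1)).mpr (by exact_mod_cast hd)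
    push_cast at this
    linear_combination this
  have hfx : f x ^ 2 = -1 := by
    have : f x = t * r := by simp [f, x, Zsqrtd.lift]
    rw [this, mul_pow, ht2, hr, one_mul]
  apply darcaisInt_sigma_ne_zero hfx n
  rw [← map_darcaisInt, hb, map_zero]
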